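/- For all integers k ≥ 1 and n ≥ 1, p^1_{n,n+k;≤n+k} = Σ_{i=1}^{n} C(n−1, i−1) · p^1_{i,i+k−1;≤i+k−1} · p_{n−i}, where C(a,b) is the binomial coefficient. -/

import Mathlib

/-- One parking step: a car with preference `a` parks in the first unoccupied
space `j` with `a ≤ j ≤ m`, if such a space exists; otherwise it leaves. -/
def parkStep (m : ℕ) (occ : Finset ℕ) (a : ℕ) : Finset ℕ :=
  if h : ((Finset.Icc a m) \ occ).Nonempty then
    insert (((Finset.Icc a m) \ occ).min' h) occ
  else occ

/-- The set of occupied spaces after the cars with preference list `l`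
(in order of arrival) have tried to park among spaces `1, …, m`. -/
def occupied (m : ℕ) (l : List ℕ) : Finset ℕ := l.foldl (parkStep m) ∅

/-- The number of cars that leave unparked. -/
def flaws (m : ℕ) (l : List ℕ) : ℕ := l.length - (occupied m l).card

/-- The preference list (with entries in `[1, s]`) encoded by a function `Fin n → Fin s`. -/
def prefList {n s : ℕ} (f : Fin n → Fin s) : List ℕ :=
  (List.ofFn f).map (fun i => (i : ℕ) + 1)

/-- `p n m s k` is the number of `k`-flaw preference sets of length `n` with `m`
parking spaces, all of whose entries are at most `s`. -/
def p (n m s k : ℕ) : ℕ :=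
  (Finset.univ.filter (fun f : Fin n → Fin s => flaws m (prefList f) = k)).card

/-- `pL n m s k l` is the number of `k`-flaw preference sets of length `n` with `m`
parking spaces, entries at most `s`, and first entry `l`. -/
def pL (n m s k l : ℕ) : ℕ :=
  (Finset.univ.filter (fun f : Fin n → Fin s =>
    flaws m (prefList f) = k ∧ (prefList f).head? = some l)).card

/-- The set of empty spaces. -/
def empties (m : ℕ) (l : List ℕ) : Finset ℕ := Finset.Icc 1 m \ occupied m l

/-- `n_α`: the number of entries equal to the first entry. -/
def nstat (l : List ℕ) : ℕ := l.count l.headI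

/-- `h_α`: the number of empty spaces smaller than the first entry. -/
def hstat (m : ℕ) (l : List ℕ) : ℕ := ((empties m l).filter (fun x => x < l.headI)).card

/-- `τ_α`: the number of entries smaller than the first entry, plus one. -/
def taustat (l : List ℕ) : ℕ := l.countP (fun a => a < l.headI) + 1

/-- `m_α`: the largest empty space. -/
def mstat (m : ℕ) (l : List ℕ) : ℕ := (empties m l).sup id

open Finset

lemma occ_append (m : ℕ) (l : List ℕ) (a : ℕ) :
    occupied m (l ++ [a]) = parkStep m (occupied m l) a := by
  simp [occupied]

lemma park_cases (m : ℕ) (occ : Finset ℕ) (a : ℕ) :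
    (parkStep m occ a = occ ∧ ∀ x, a ≤ x → x ≤ m → x ∈ occ) ∨
    ∃ x, parkStep m occ a = insert x occ ∧ x ∉ occ ∧ a ≤ x ∧ x ≤ m ∧
      ∀ y, a ≤ y → y < x → y ∈ occ := by
  unfold parkStep
  split_ifs with h
  · right
    have h1 := Finset.min'_mem _ h
    refine ⟨_, rfl, ?_, ?_, ?_, ?_⟩
    · simp only [mem_sdiff, mem_Icc] at h1; exact h1.2
    · simp only [mem_sdiff, mem_Icc] at h1; exact h1.1.1
    · simp only [mem_sdiff, mem_Icc] at h1; exact h1.1.2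
    · intro y hy hyx
      by_contra hc
      have h3 : y ∈ Icc a m \ occ := by
        simp only [mem_sdiff, mem_Icc] at h1 ⊢
        exact ⟨⟨hy, by omega⟩, hc⟩
      have := Finset.min'_le _ _ h3
      omega
  · left
    refine ⟨rfl, fun x h1 h2 => ?_⟩
    by_contra hc
    exact h ⟨x, by simp [h1, h2, hc]⟩

lemma occ_inv (m : ℕ) (l : List ℕ) (hl : ∀ a ∈ l, 1 ≤ a) :
    (occupied m l ⊆ Icc 1 m) ∧ (occupied m l).card ≤ l.length ∧
    (∀ e, e ∉ occupied m l → e ≤ m →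
      ((occupied m l).filter (fun x => e < x)).card ≤ l.countP (fun a => e < a)) ∧
    ((occupied m l).card = l.length →
      ∀ t, l.countP (fun a => t ≤ a) ≤ ((occupied m l).filter (fun x => t ≤ x)).card) := by
  induction l using List.reverseRecOn with
  | nil => simp [occupied]
  | append_singleton l a ih =>
    obtain ⟨h1, h2, h3, h4⟩ := ih (fun b hb => hl b (by simp [hb]))
    have ha : 1 ≤ a := hl a (by simp)
    rw [occ_append]
    rcases park_cases m (occupied m l) a with ⟨he, hf⟩ | ⟨x, he, hx, hax, hxm, hmin⟩
    · rw [he]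
      refine ⟨h1, by simp; omega, ?_, ?_⟩
      · intro e he1 he2
        have := h3 e he1 he2
        rw [List.countP_append]; omega
      · intro hc
        simp at hc; omega
    · rw [he]
      refine ⟨?_, ?_, ?_, ?_⟩
      · intro y hy
        rcases Finset.mem_insert.1 hy with rfl | hy
        · simp; omega
        · exact h1 hy
      · rw [card_insert_of_notMem hx]; simp; omega
      · intro e he1 he2
        simp only [Finset.mem_insert, not_or] at he1
        have := h3 e he1.2 he2
        rw [List.countP_append, filter_insert]
        split_ifs with hex
        · have : e < a := by
            by_contra hc
            exact he1.2 (hmin e (by omega) hex)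
          rw [card_insert_of_notMem (by simp [hx])]
          simp [this]; omega
        · omega
      · intro hc t
        rw [card_insert_of_notMem hx] at hc
        have := h4 (by simpa using hc) t
        rw [List.countP_append, filter_insert]
        split_ifs with htx
        · rw [card_insert_of_notMem (by simp [hx])]
          have : List.countP (fun a => decide (t ≤ a)) [a] ≤ 1 := List.countP_le_length
          omega
        · have : ¬ t ≤ a := by omega
          simp [this]; omega

lemma flaws_iff (m : ℕ) (l : List ℕ) (hl : ∀ a ∈ l, 1 ≤ a) :
    flaws m l = 0 ↔ ∀ t, 1 ≤ t → l.countP (fun a => t ≤ a) ≤ m + 1 - t := by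
  have hfl : ∀ l : List ℕ, (∀ a ∈ l, 1 ≤ a) → (flaws m l = 0 ↔ (occupied m l).card = l.length) := by
    intro l hl
    have := (occ_inv m l hl).2.1
    unfold flaws; omega
  rw [hfl l hl]
  constructor
  · intro h t ht
    obtain ⟨h1, h2, h3, h4⟩ := occ_inv m l hl
    refine (h4 h t).trans ?_
    rw [← Nat.card_Icc]
    apply card_le_card
    intro x hx
    simp only [mem_filter] at hx
    have := h1 hx.1
    simp only [mem_Icc] at this ⊢
    omega
  · induction l using List.reverseRecOn with
    | nil => simp [occupied]
    | append_singleton l a ih =>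
      intro h
      have hl' : ∀ b ∈ l, 1 ≤ b := fun b hb => hl b (by simp [hb])
      have ha : 1 ≤ a := hl a (by simp)
      have ih := ih hl' (fun t ht => by
        have := h t ht
        rw [List.countP_append] at this; omega)
      obtain ⟨h1, h2, h3, h4⟩ := occ_inv m l hl'
      rw [occ_append]
      rcases park_cases m (occupied m l) a with ⟨he, hf⟩ | ⟨x, he, hx, hax, hxm, hmin⟩
      · exfalso
        have h0 : 0 ∉ occupied m l := fun hc => by simpa using h1 hc
        by_cases ham : a ≤ m
        · -- largest free space below
          have hex : ∃ e, e ≤ a ∧ e ∉ occupied m l ∧ ∀ y, e < y → y ≤ a → y ∈ occupied m l := by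
            have hne : ((range (a+1)).filter (fun e => e ∉ occupied m l)).Nonempty :=
              ⟨0, by simp [h0]⟩
            refine ⟨((range (a+1)).filter (fun e => e ∉ occupied m l)).max' hne, ?_, ?_, ?_⟩
            · have := max'_mem _ hne
              simp only [mem_filter, mem_range] at this; omega
            · have := max'_mem _ hne
              simp only [mem_filter, mem_range] at this; exact this.2
            · intro y hy hya
              by_contra hc
              have := le_max' ((range (a+1)).filter (fun e => e ∉ occupied m l)) y
                (by simp [hc]; omega)
              omega
          obtain ⟨e, he1, he2, he3⟩ := hex
          have hea : e < a := by
            rcases he1.lt_or_eq with h' | rfl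
            · exact h'
            · exact absurd (hf e le_rfl ham) he2
          have k1 := h3 e he2 (by omega)
          have k2 := h (e+1) (by omega)
          have k3 : m - e ≤ ((occupied m l).filter (fun x => e < x)).card := by
            rw [← Nat.card_Ioc]
            apply card_le_card
            intro y hy
            simp only [mem_Ioc] at hy
            simp only [mem_filter]
            refine ⟨?_, hy.1⟩
            by_cases hya : y ≤ a
            · exact he3 y hy.1 hya
            · exact hf y (by omega) hy.2
          rw [List.countP_append] at k2
          have k4 : l.countP (fun a => e < a) = l.countP (fun a => e + 1 ≤ a) := rfl
          have k5 : List.countP (fun b => decide (e + 1 ≤ b)) [a] = 1 := by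
            simp; omega
          omega
        · have := h a ha
          rw [List.countP_append] at this
          simp at this
          omega
      · rw [he, card_insert_of_notMem hx, ih]; simp

lemma countP_ofFn {n : ℕ} (f : Fin n → ℕ) (P : ℕ → Prop) [DecidablePred P] :
    (List.ofFn f).countP (fun a => P a) = (univ.filter (fun i => P (f i))).card := by
  induction n with
  | zero => simp
  | succ n ih =>
    rw [List.ofFn_succ, List.countP_cons, ih, Fin.card_filter_univ_succ']
    simp [Function.comp_def]; omega

/-- The counting condition, with `c` additional cars preferring the first space. -/
def QQ (c : ℕ) {α : Type} [Fintype α] (m : ℕ) (f : α → ℕ) : Prop :=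
  Fintype.card α + c ≤ m ∧ ∀ t, 1 ≤ t → (univ.filter (fun a => t ≤ f a)).card ≤ m - t

lemma QQ.lt {c : ℕ} {α : Type} [Fintype α] {m : ℕ} {f : α → ℕ} (h : QQ c m f) (a : α) :
    f a < m := by
  have h0 := h.1
  have : 0 < Fintype.card α := Fintype.card_pos_iff.2 ⟨a⟩
  have h2 := h.2 m (by omega)
  by_contra hc
  have : 0 < (univ.filter (fun a => m ≤ f a)).card :=
    card_pos.2 ⟨a, by simp; omega⟩
  omega

/-- number of functions satisfying `QQ`. -/
noncomputable def cnt (c : ℕ) (α : Type) [Fintype α] (m : ℕ) : ℕ := Nat.card {f : α → ℕ // QQ c m f}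

instance QQfin (c : ℕ) (α : Type) [Fintype α] (m : ℕ) : Finite {f : α → ℕ // QQ c m f} := by
  apply Finite.of_injective (β := α → Fin m) (fun f a => ⟨f.1 a, f.2.lt a⟩)
  intro f g h
  ext a
  have := congrFun h a
  simpa using this

lemma cnt_congr (c : ℕ) {α β : Type} [Fintype α] [Fintype β] (e : α ≃ β) (m : ℕ) :
    cnt c α m = cnt c β m := by
  unfold cnt
  apply Nat.card_congr
  refine Equiv.subtypeEquiv (Equiv.arrowCongr e (Equiv.refl ℕ)) ?_
  intro f
  unfold QQ
  rw [Fintype.card_congr e]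
  have : ∀ t, (univ.filter (fun a => t ≤ f a)).card =
      (univ.filter (fun a => t ≤ (Equiv.arrowCongr e (Equiv.refl ℕ)) f a)).card := by
    intro t
    apply card_bij (fun a _ => e a)
    · simp
    · simp
    · intro b hb
      exact ⟨e.symm b, by simpa using hb, by simp⟩
  simp only [this]

lemma prefList_eq {n s : ℕ} (f : Fin n → Fin s) :
    prefList f = List.ofFn (fun i => (f i : ℕ) + 1) := by
  have h : ∀ l : List (Fin s), List.flatMap (fun a : Fin s => [(a : ℕ)]) l = l.map (fun a : Fin s => (a : ℕ)) := by
    intro l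
    induction l with
    | nil => rfl
    | cons a l ih => simp [List.flatMap_cons, ih]
  simp [prefList, h, List.map_ofFn, Function.comp_def]

lemma flaws_pref {n m : ℕ} (f : Fin n → Fin m) :
    flaws m (prefList f) = 0 ↔ QQ 0 m (fun i => (f i : ℕ)) := by
  rw [flaws_iff _ _ (by simp [prefList_eq]), prefList_eq]
  simp only [countP_ofFn]
  unfold QQ
  constructor
  · intro h
    refine ⟨?_, fun t ht => ?_⟩
    · have := h 1 le_rfl
      simpa using this
    · have := h (t+1) (by omega)
      simpa using this
  · rintro ⟨h0, h⟩ t ht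
    obtain ⟨t, rfl⟩ : ∃ u, t = u + 1 := ⟨t - 1, by omega⟩
    rcases Nat.eq_zero_or_pos t with rfl | h'
    · simpa using h0
    · simpa using h t h'

lemma p_eq (n m : ℕ) : p n m m 0 = cnt 0 (Fin n) m := by
  unfold p cnt
  rw [← Fintype.card_subtype, ← Nat.card_eq_fintype_card]
  apply Nat.card_congr
  refine ⟨fun f => ⟨fun i => (f.1 i : ℕ), (flaws_pref f.1).1 f.2⟩,
    fun g => ⟨fun i => ⟨g.1 i, g.2.lt i⟩, (flaws_pref _).2 g.2⟩, ?_, ?_⟩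
  · intro f; rfl
  · intro g; rfl

lemma QQ_cons {n m : ℕ} (g : Fin n → ℕ) :
    QQ 0 m (Fin.cons 0 g : Fin (n+1) → ℕ) ↔ QQ 1 m g := by
  unfold QQ
  refine and_congr (by simp) (forall_congr' fun t => imp_congr_right fun ht => ?_)
  rw [Fin.card_filter_univ_succ']
  have : ¬ t ≤ 0 := by omega
  simp only [Fin.cons_zero, if_neg this, Function.comp_def, Fin.cons_succ, zero_add]

lemma pL_eq (n m : ℕ) : pL (n+1) m m 0 1 = cnt 1 (Fin n) m := by
  unfold pL cnt
  rw [← Fintype.card_subtype, ← Nat.card_eq_fintype_card]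
  have key : ∀ f : Fin (n+1) → Fin m,
      (flaws m (prefList f) = 0 ∧ (prefList f).head? = some 1) ↔
      ((f 0 : ℕ) = 0 ∧ QQ 1 m (fun i : Fin n => (f i.succ : ℕ))) := by
    intro f
    rw [flaws_pref, prefList_eq, List.ofFn_succ, ← QQ_cons, and_comm]
    simp only [List.head?_cons, Option.some.injEq, Nat.add_eq_right]
    refine and_congr_right fun h0 => ?_
    have : (fun i => (f i : ℕ)) = (Fin.cons 0 (fun i : Fin n => (f i.succ : ℕ)) : Fin (n+1) → ℕ) := by
      ext i
      refine Fin.cases ?_ (fun i => ?_) i <;> simp [h0]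
    rw [this]
  apply Nat.card_congr
  refine ⟨fun f => ⟨fun i => (f.1 i.succ : ℕ), ((key f.1).1 f.2).2⟩,
    fun g => ⟨Fin.cons ⟨0, by have := g.2.1; omega⟩ (fun i => ⟨g.1 i, g.2.lt i⟩),
      (key _).2 ⟨by simp, by simpa using g.2⟩⟩, ?_, ?_⟩
  · intro f
    apply Subtype.ext
    funext i
    refine Fin.cases ?_ (fun i => ?_) i
    · have := ((key f.1).1 f.2).1
      apply Fin.ext; simp [this]
    · rfl
  · intro g
    apply Subtype.ext
    funext i
    simp

lemma card_sub {α : Type} [Fintype α] (q : α → Prop) [DecidablePred q] [Fintype {a // q a}] (P : α → Prop)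
    [DecidablePred P] :
    (univ.filter (fun a : {a // q a} => P a.1)).card = (univ.filter (fun a => q a ∧ P a)).card := by
  apply card_bij (fun a _ => a.1)
  · intro a ha; simp only [mem_filter, mem_univ, true_and] at ha ⊢; exact ⟨a.2, ha⟩
  · intro a _ b _ h; exact Subtype.ext h
  · intro b hb; simp only [mem_filter, mem_univ, true_and] at hb
    exact ⟨⟨b, hb.1⟩, by simpa using hb.2, rfl⟩

/-- decomposition predicate -/
def RR {N : ℕ} (k : ℕ) (S : Finset (Fin N)) (f : Fin N → ℕ) : Prop :=
  QQ 1 (S.card + k) (fun a : {a // a ∈ S} => f a) ∧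
  (∀ a, a ∉ S → S.card + 1 + k ≤ f a) ∧
  QQ 0 (N - S.card) (fun a : {a // a ∉ S} => f a - (S.card + 1 + k))

lemma RR_lt {N k : ℕ} {S : Finset (Fin N)} {f : Fin N → ℕ} (h : RR k S f) (a : Fin N)
    (ha : a ∈ S) : f a < S.card + k := h.1.lt ⟨a, ha⟩

lemma RR_cnt {N k : ℕ} {S : Finset (Fin N)} {f : Fin N → ℕ} (h : RR k S f) (t : ℕ) (ht : 1 ≤ t) :
    (univ.filter (fun a => a ∈ S ∧ t ≤ f a)).card ≤ S.card + k - t := by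
  have := h.1.2 t ht
  have e := card_sub (fun a => a ∈ S) (fun a => t ≤ f a)
  exact e ▸ this

lemma card_split {N : ℕ} (S : Finset (Fin N)) (f : Fin N → ℕ) (t : ℕ) :
    (univ.filter (fun a => t ≤ f a)).card =
    (univ.filter (fun a => a ∈ S ∧ t ≤ f a)).card + (univ.filter (fun a => a ∉ S ∧ t ≤ f a)).card := by
  rw [← card_filter_add_card_filter_not (s := univ.filter (fun a => t ≤ f a)) (fun a => a ∈ S)]
  simp only [filter_filter, and_comm]

lemma card_notin {N : ℕ} (S : Finset (Fin N)) : (univ.filter (fun a => a ∉ S)).card = N - S.card := by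
  have : univ.filter (fun a => a ∉ S) = Sᶜ := by ext; simp
  rw [this, card_compl, Fintype.card_fin]

lemma RR_Q {N k : ℕ} {S : Finset (Fin N)} {f : Fin N → ℕ} (h : RR k S f) :
    QQ 1 (N + 1 + k) f := by
  have hS : S.card ≤ N := by simpa using card_le_univ S
  refine ⟨by simp, fun t ht => ?_⟩
  rw [card_split S]
  have h1 := RR_cnt h t ht
  by_cases hT : t ≤ S.card + 1 + k
  · have h2 : (univ.filter (fun a => a ∉ S ∧ t ≤ f a)).card ≤ N - S.card := by
      rw [← card_notin S]
      apply card_le_card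
      intro a; simp; tauto
    by_cases hT' : t = S.card + 1 + k <;> omega
  · have h2 := h.2.2.2 (t - (S.card + 1 + k)) (by omega)
    rw [card_sub (fun a => a ∉ S) (fun a => t - (S.card + 1 + k) ≤ f a - (S.card + 1 + k))] at h2
    have h3 : (univ.filter (fun a => a ∉ S ∧ t ≤ f a)).card ≤
        (univ.filter (fun a => a ∉ S ∧ t - (S.card + 1 + k) ≤ f a - (S.card + 1 + k))).card := by
      apply card_le_card
      intro a
      simp only [mem_filter, mem_univ, true_and]
      rintro ⟨h, h'⟩
      exact ⟨h, by omega⟩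
    omega

lemma RR_uniq_le {N k : ℕ} {S S' : Finset (Fin N)} {f : Fin N → ℕ} (h : RR k S f)
    (h' : RR k S' f) (hc : S.card ≤ S'.card) : S = S' := by
  have hS : S'.card ≤ N := by simpa using card_le_univ S'
  have hsub : S ⊆ S' := by
    intro a ha
    by_contra hc'
    have := h'.2.1 a hc'
    have := RR_lt h a ha
    omega
  refine eq_of_subset_of_card_le hsub ?_
  by_contra hlt
  have h1 := RR_cnt h' (S.card + 1 + k) (by omega)
  have h2 : (S' \ S).card ≤ (univ.filter (fun a => a ∈ S' ∧ S.card + 1 + k ≤ f a)).card := by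
    apply card_le_card
    intro a ha
    simp only [mem_sdiff, mem_filter, mem_univ, true_and] at ha ⊢
    exact ⟨ha.1, h.2.1 a ha.2⟩
  rw [card_sdiff_of_subset hsub] at h2
  omega

lemma RR_uniq {N k : ℕ} {S S' : Finset (Fin N)} {f : Fin N → ℕ} (h : RR k S f)
    (h' : RR k S' f) : S = S' := by
  rcases le_total S.card S'.card with hc | hc
  · exact RR_uniq_le h h' hc
  · exact (RR_uniq_le h' h hc).symm

lemma RR_exists {N k : ℕ} (hk : 1 ≤ k) {f : Fin N → ℕ} (h : QQ 1 (N + 1 + k) f) :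
    ∃ S, RR k S f := by
  classical
  let c : ℕ → ℕ := fun t => (univ.filter (fun a => t ≤ f a)).card
  have hc : ∀ t, c t = (univ.filter (fun a => t ≤ f a)).card := fun _ => rfl
  have hcN : ∀ t, c t ≤ N := fun t => by
    have := card_le_univ (univ.filter (fun a => t ≤ f a))
    simpa [hc] using this
  have hQ : ∀ t, c t ≤ N + 1 + k - t := by
    intro t
    rcases Nat.eq_zero_or_pos t with rfl | ht
    · have := hcN 0; omega
    · exact h.2 t ht
  have hex : ∃ t, c t = N + 1 + k - t := ⟨N + 1 + k, by have := hQ (N+1+k); omega⟩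
  obtain ⟨T, hT, hmin⟩ : ∃ T, c T = N + 1 + k - T ∧ ∀ t < T, c t ≠ N + 1 + k - t :=
    ⟨Nat.find hex, Nat.find_spec hex, fun t ht => Nat.find_min hex ht⟩
  have hmin' : ∀ t < T, c t + 1 ≤ N + 1 + k - t := fun t ht => by
    have := hQ t; have := hmin t ht; omega
  have hTN : T ≤ N + 1 + k := by
    by_contra hcon
    have := hmin' (N+1+k) (by omega)
    omega
  have hT1 : k + 1 ≤ T := by have := hcN T; omega
  let S : Finset (Fin N) := univ.filter (fun a => f a < T)
  have hmem : ∀ a, a ∈ S ↔ f a < T := fun a => by simp [S]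
  have hSc : S.card + c T = N := by
    have := card_filter_add_card_filter_not (s := (univ : Finset (Fin N))) (fun a => f a < T)
    simpa [S, hc] using this
  have hTS : T = S.card + 1 + k := by omega
  have hsplit : ∀ t, t ≤ T → c t = (univ.filter (fun a => a ∈ S ∧ t ≤ f a)).card + c T := by
    intro t ht
    rw [hc, card_split S, hc]
    congr 2
    ext a
    simp only [mem_filter, mem_univ, true_and, hmem]
    omega
  refine ⟨S, ⟨by simp; omega, fun t ht => ?_⟩, ?_, ?_, fun t ht => ?_⟩
  · change (univ.filter (fun a : {a // a ∈ S} => t ≤ f a.1)).card ≤ _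
    rw [card_sub (fun a => a ∈ S) (fun a => t ≤ f a)]
    by_cases htT : t < T
    · have h1 := hsplit t htT.le
      have h2 := hmin' t htT
      omega
    · have : (univ.filter (fun a => a ∈ S ∧ t ≤ f a)) = ∅ := by
        ext a
        simp only [mem_filter, mem_univ, true_and, hmem, notMem_empty, iff_false]
        omega
      rw [this]; simp
  · intro a ha
    rw [hmem] at ha
    omega
  · rw [Fintype.card_subtype, card_notin]; omega
  · rw [card_sub (fun a => a ∉ S) (fun a => t ≤ f a - (S.card + 1 + k))]
    have h1 := hQ (t + T)
    have h2 : (univ.filter (fun a => a ∉ S ∧ t ≤ f a - (S.card + 1 + k))).card ≤ c (t + T) := by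
      apply card_le_card
      intro a
      simp only [mem_filter, mem_univ, true_and, hmem]
      omega
    omega

lemma RR_card {N k : ℕ} (S : Finset (Fin N)) :
    Nat.card {f : Fin N → ℕ // RR k S f} =
      cnt 1 (Fin S.card) (S.card + k) * cnt 0 (Fin (N - S.card)) (N - S.card) := by
  have e1 : {a // a ∈ S} ≃ Fin S.card := Fintype.equivFinOfCardEq (by simp)
  have e2 : {a // a ∉ S} ≃ Fin (N - S.card) :=
    Fintype.equivFinOfCardEq (by rw [Fintype.card_subtype, card_notin])
  rw [← cnt_congr 1 e1, ← cnt_congr 0 e2]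
  unfold cnt
  rw [← Nat.card_prod]
  apply Nat.card_congr
  refine ⟨fun f => (⟨_, f.2.1⟩, ⟨_, f.2.2.2⟩),
    fun g => ⟨fun a => if h : a ∈ S then g.1.1 ⟨a, h⟩ else g.2.1 ⟨a, h⟩ + (S.card + 1 + k), ?_, ?_, ?_⟩,
    ?_, ?_⟩
  · convert g.1.2 using 2 with a
    simp
  · intro a ha
    simp [ha]
  · convert g.2.2 using 2 with a
    simp [a.2]
  · intro f
    apply Subtype.ext
    funext a
    by_cases ha : a ∈ S
    · simp [ha]
    · have := f.2.2.1 a ha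
      simp [ha]; omega
  · rintro ⟨g, h⟩
    refine Prod.ext (Subtype.ext (funext fun a => ?_)) (Subtype.ext (funext fun a => ?_))
    · simp
    · simp [a.2]

lemma cnt_rec (N k : ℕ) (hk : 1 ≤ k) :
    cnt 1 (Fin N) (N + 1 + k) = ∑ j ∈ range (N + 1),
      N.choose j * (cnt 1 (Fin j) (j + k) * cnt 0 (Fin (N - j)) (N - j)) := by
  have hfin : ∀ S : Finset (Fin N), Finite {f : Fin N → ℕ // RR k S f} := fun S =>
    Finite.of_injective (β := {f : Fin N → ℕ // QQ 1 (N + 1 + k) f})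
      (fun f => ⟨f.1, RR_Q f.2⟩) (fun f g h => by
        have h : f.1 = g.1 := congrArg (fun x => x.1) h
        exact Subtype.ext h)
  have h1 : cnt 1 (Fin N) (N + 1 + k) = Nat.card (Σ S : Finset (Fin N), {f : Fin N → ℕ // RR k S f}) := by
    unfold cnt
    symm
    apply Nat.card_eq_of_bijective (fun x => ⟨x.2.1, RR_Q x.2.2⟩)
    constructor
    · rintro ⟨S, f, hf⟩ ⟨S', g, hg⟩ h
      have h : f = g := congrArg Subtype.val h
      subst h
      obtain rfl := RR_uniq hf hg
      rfl
    · rintro ⟨f, hf⟩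
      obtain ⟨S, hS⟩ := RR_exists hk hf
      exact ⟨⟨S, f, hS⟩, rfl⟩
  rw [h1, Nat.card_sigma]
  simp only [RR_card]
  have := Finset.sum_powerset_apply_card
    (fun j => cnt 1 (Fin j) (j + k) * cnt 0 (Fin (N - j)) (N - j)) (x := (univ : Finset (Fin N)))
  rw [powerset_univ] at this
  rw [this]
  simp

/-- Theorem 4.2(2): for `k ≥ 1` and `n ≥ 1`,
`p^1_{n,n+k;≤n+k} = Σ_{i=1}^n C(n-1, i-1) · p^1_{i,i+k-1;≤i+k-1} · p_{n-i}`. -/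
theorem stmt3 (n k : ℕ) (hn : 1 ≤ n) (hk : 1 ≤ k) :
    pL n (n + k) (n + k) 0 1 =
      ∑ i ∈ Finset.Icc 1 n,
        Nat.choose (n - 1) (i - 1) * pL i (i + k - 1) (i + k - 1) 0 1 *
          p (n - i) (n - i) (n - i) 0 := by
  obtain ⟨N, rfl⟩ : ∃ N, n = N + 1 := ⟨n - 1, by omega⟩
  rw [pL_eq, cnt_rec N k hk]
  refine Finset.sum_bij (fun j _ => j + 1) ?_ ?_ ?_ ?_
  · intro j hj
    simp only [Finset.mem_range, Finset.mem_Icc] at hj ⊢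
    omega
  · intro a _ b _ h
    omega
  · intro b hb
    simp only [Finset.mem_Icc] at hb
    exact ⟨b - 1, by simp only [Finset.mem_range]; omega, by omega⟩
  · intro j hj
    have h1 : j + 1 + k - 1 = j + k := by omega
    have h2 : N + 1 - (j + 1) = N - j := by omega
    rw [h1, h2, pL_eq, p_eq]
    simp [mul_assoc]
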